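/- Let G be a finite connected simple graph of order n > 1. Then there exists an integer d such that at least ⌈2n/τ(G)⌉ vertices of G have detour order equal to d. -/

import Mathlib

open SimpleGraph

/-- The detour order of a vertex `v`: the maximum number of vertices of a path
in `G` having `v` as an endvertex. -/
noncomputable def vertexDetourOrder {V : Type*} (G : SimpleGraph V) (v : V) : ℕ :=
  sSup {n | ∃ (w : V) (p : G.Walk v w), p.IsPath ∧ n = p.length + 1}

/-- The detour order of `G`: the maximum number of vertices of a path in `G`. -/
noncomputable def detourOrder {V : Type*} (G : SimpleGraph V) : ℕ :=
  sSup {n | ∃ (u w : V) (p : G.Walk u w), p.IsPath ∧ n = p.length + 1}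

/-- A graph is traceable if it has a hamiltonian path, i.e. a path through all vertices. -/
def Traceable {V : Type*} (G : SimpleGraph V) : Prop :=
  ∃ (u w : V) (p : G.Walk u w), p.IsPath ∧ ∀ x, x ∈ p.support

lemma aux_bddV {V : Type*} [Fintype V] (G : SimpleGraph V) (v : V) :
    BddAbove {n | ∃ (w : V) (p : G.Walk v w), p.IsPath ∧ n = p.length + 1} := by
  refine ⟨Fintype.card V, ?_⟩
  rintro n ⟨w, p, hp, rfl⟩
  exact hp.length_lt

lemma aux_bdd {V : Type*} [Fintype V] (G : SimpleGraph V) :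
    BddAbove {n | ∃ (u w : V) (p : G.Walk u w), p.IsPath ∧ n = p.length + 1} := by
  refine ⟨Fintype.card V, ?_⟩
  rintro n ⟨u, w, p, hp, rfl⟩
  exact hp.length_lt

lemma aux_le {V : Type*} [Fintype V] (G : SimpleGraph V) {v w : V} (p : G.Walk v w)
    (hp : p.IsPath) : p.length + 1 ≤ vertexDetourOrder G v :=
  le_csSup (aux_bddV G v) ⟨w, p, hp, rfl⟩

lemma aux_le2 {V : Type*} [Fintype V] (G : SimpleGraph V) {v w : V} (p : G.Walk v w)
    (hp : p.IsPath) : p.length + 1 ≤ detourOrder G :=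
  le_csSup (aux_bdd G) ⟨v, w, p, hp, rfl⟩

lemma aux_ord_le {V : Type*} [Fintype V] (G : SimpleGraph V) (v : V) :
    vertexDetourOrder G v ≤ detourOrder G := by
  refine csSup_le ⟨_, v, Walk.nil, Walk.IsPath.nil, rfl⟩ ?_
  rintro n ⟨w, p, hp, rfl⟩
  exact aux_le2 G p hp

lemma aux_first {V : Type*} (G : SimpleGraph V) (S : Set V) {v u : V} (r : G.Walk v u)
    (hu : u ∈ S) : ∃ x ∈ S, ∃ q : G.Walk v x, q.IsPath ∧ ∀ y ∈ q.support, y ∈ S → y = x := by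
  classical
  induction r with
  | nil => exact ⟨_, hu, Walk.nil, Walk.IsPath.nil, by simp⟩
  | @cons a b c h r ih =>
    by_cases ha : a ∈ S
    · exact ⟨a, ha, Walk.nil, Walk.IsPath.nil, by simp⟩
    · obtain ⟨x, hx, q, hq, hy⟩ := ih hu
      refine ⟨x, hx, (Walk.cons h q).bypass, Walk.bypass_isPath _, ?_⟩
      intro y hy1 hyS
      have := Walk.support_bypass_subset_support _ hy1
      rw [Walk.support_cons, List.mem_cons] at this
      rcases this with rfl | h1
      · exact absurd hyS ha
      · exact hy y h1 hyS

lemma aux_append {V : Type*} (G : SimpleGraph V) {a b c : V} (q : G.Walk a b) (p : G.Walk b c)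
    (hq : q.IsPath) (hp : p.IsPath) (h : ∀ y ∈ q.support, y ∈ p.support → y = b) :
    (q.append p).IsPath := by
  rw [Walk.isPath_def, Walk.support_append, List.nodup_append]
  have hpn := hp.support_nodup
  rw [← Walk.cons_tail_support p, List.nodup_cons] at hpn
  refine ⟨hq.support_nodup, hpn.2, ?_⟩
  rintro x hx y hy rfl
  have := h x hx (List.mem_of_mem_tail hy)
  subst this
  exact hpn.1 hy

lemma aux_lower {V : Type*} [Fintype V] (G : SimpleGraph V) (hG : G.Connected)
    {u w : V} (p : G.Walk u w) (hp : p.IsPath) (v : V)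
    (hv : v ≠ p.getVert (p.length / 2) ∨ p.length % 2 = 1) :
    (p.length + 1) - (p.length + 1) / 2 < vertexDetourOrder G v := by
  classical
  obtain ⟨r⟩ := hG.preconnected v u
  obtain ⟨x, hx, q, hq, hy⟩ := aux_first G {y | y ∈ p.support} r p.start_mem_support
  have hx : x ∈ p.support := hx
  have h1 := aux_le G _ (aux_append G q (p.dropUntil x hx) hq (hp.dropUntil hx)
    (fun y h1 h2 => hy y h1 (p.support_dropUntil_subset_support hx h2)))
  have h2 := aux_le G _ (aux_append G q (p.takeUntil x hx).reverse hq (hp.takeUntil hx).reverse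
    (fun y h1 h2 => hy y h1 (p.support_takeUntil_subset_support hx (by simpa using h2))))
  have h3 := congrArg Walk.length (p.take_spec hx)
  rw [Walk.length_append] at h1 h2 h3
  rw [Walk.length_reverse] at h2
  by_contra hc
  have hq0 : q.length = 0 := by omega
  have hvx : v = x := Walk.eq_of_length_eq_zero hq0
  have h4 := Walk.getVert_length_takeUntil hx
  have h5 : (p.takeUntil x hx).length = p.length / 2 := by omega
  rw [h5] at h4
  rcases hv with hv | hv
  · exact hv (hvx.trans h4.symm)
  · omega

theorem stmt_3 {V : Type*} [Fintype V] (G : SimpleGraph V) (hG : G.Connected)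
    (hn : 1 < Fintype.card V) :
    ∃ d : ℕ,
      (2 * Fintype.card V + detourOrder G - 1) / detourOrder G ≤
        {v : V | vertexDetourOrder G v = d}.ncard := by
  classical
  obtain ⟨v0⟩ := hG.nonempty
  obtain ⟨u, w, p, hp, hτ⟩ : detourOrder G ∈
      {n | ∃ (u w : V) (p : G.Walk u w), p.IsPath ∧ n = p.length + 1} :=
    Nat.sSup_mem ⟨_, v0, v0, Walk.nil, Walk.IsPath.nil, rfl⟩ (aux_bdd G)
  have hlt : p.length + 1 ≤ Fintype.card V := hp.length_lt
  by_contra! hcon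
  set C := (2 * Fintype.card V + detourOrder G - 1) / detourOrder G with hC
  have hCτ : C * detourOrder G ≤ 2 * Fintype.card V + detourOrder G - 1 := Nat.div_mul_le_self _ _
  obtain ⟨m, hm⟩ : ∃ m, C = m + 1 := ⟨C - 1, by have := hcon 0; omega⟩
  have key : ∀ s : Finset V, (∀ v ∈ s, v ≠ p.getVert (p.length / 2) ∨ p.length % 2 = 1) →
      s.card ≤ m * ((p.length + 1) / 2) := by
    intro s hs
    have h := Finset.card_le_mul_card_image_of_maps_to (s := s) (f := vertexDetourOrder G)
      (t := Finset.Ioc ((p.length + 1) - (p.length + 1) / 2) (p.length + 1)) ?_ m ?_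
    · rw [Nat.card_Ioc] at h
      convert h using 2
      omega
    · intro v hv
      rw [Finset.mem_Ioc]
      exact ⟨aux_lower G hG p hp v (hs v hv), hτ ▸ aux_ord_le G v⟩
    · intro d _
      have h1 := hcon d
      have h2 : (s.filter (fun a => vertexDetourOrder G a = d)).card ≤
          {v : V | vertexDetourOrder G v = d}.ncard := by
        rw [← Set.ncard_coe_finset]
        apply Set.ncard_le_ncard _ (Set.toFinite _)
        intro x hx
        simpa using (Finset.mem_filter.1 hx).2
      omega
  rw [hm, hτ] at hCτ
  have hmτ : m * (p.length + 1) < 2 * Fintype.card V := by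
    rw [Nat.add_mul] at hCτ
    omega
  rcases Nat.mod_two_eq_zero_or_one p.length with h0 | h1
  · have h := key (Finset.univ.erase (p.getVert (p.length / 2)))
      (fun v hv => Or.inl (Finset.ne_of_mem_erase hv))
    rw [Finset.card_erase_of_mem (Finset.mem_univ _), Finset.card_univ] at h
    obtain ⟨k, hk⟩ : ∃ k, p.length = 2 * k := ⟨p.length / 2, by omega⟩
    rw [hk] at h hmτ hlt
    have e : (2 * k + 1) / 2 = k := by omega
    rw [e] at h
    obtain ⟨n, hn'⟩ : ∃ n, Fintype.card V = n + 1 := ⟨Fintype.card V - 1, by omega⟩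
    rw [hn'] at h hmτ hlt hn
    simp only [Nat.add_sub_cancel] at h
    have hk0 : k ≠ 0 := by
      rintro rfl
      omega
    nlinarith [Nat.pos_of_ne_zero hk0]
  · have h := key Finset.univ (fun v _ => Or.inr h1)
    rw [Finset.card_univ] at h
    obtain ⟨k, hk⟩ : ∃ k, p.length + 1 = 2 * k := ⟨(p.length + 1) / 2, by omega⟩
    rw [hk] at h hmτ
    have e : (2 * k) / 2 = k := by omega
    rw [e] at h
    nlinarith
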